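/- arXiv:2512.01005 — 10 statements merged into one kernel-verified Lean document; each statement's English description precedes it below -/
import Mathlib

section
/- Let a₀, a₁, a₂ be real numbers with a₁ ≠ 0 and a₂ ≠ 0. Let F : ℕ → ℤ → ℝ satisfy F(0,0) = 1, F(n,k) = 0 whenever k < 0 or k > n, and for all n ≥ 1 and 0 ≤ k ≤ n the recurrence F(n,k) = (a₂·n + a₁·k + a₀)·F(n-1,k) + F(n-1,k-1). Then for all n and all 0 ≤ k ≤ n, F(n,k) = (1/(a₁^k · k!)) · ∑_{j=0}^{k} (-1)^{k-j} · C(k,j) · ∏_{r=1}^{n} (a₀ + a₁·j + r·a₂). -/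
/-- The `k`-th finite difference of `f` at `0`. -/
noncomputable def altBinomSum (f : ℕ → ℝ) (k : ℕ) : ℝ :=
  ∑ j ∈ Finset.range (k + 1), (-1 : ℝ) ^ (k - j) * (Nat.choose k j : ℝ) * f j

theorem altBinomSum_one (k : ℕ) : altBinomSum (fun _ => 1) k = if k = 0 then 1 else 0 := by
  have h := add_pow (1 : ℝ) (-1) k
  simp only [one_pow, one_mul, add_neg_cancel, zero_pow_eq] at h
  simp [altBinomSum, h]

theorem altBinomSum_affine_mul_zero (f : ℕ → ℝ) (c d : ℝ) :
    altBinomSum (fun j => f j * (c + d * j)) 0 = c * altBinomSum f 0 := by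
  simp [altBinomSum, mul_comm]

theorem altBinomSum_affine_mul_succ (f : ℕ → ℝ) (c d : ℝ) (k : ℕ) :
    altBinomSum (fun j => f j * (c + d * j)) (k + 1) =
      (c + d * (k + 1)) * altBinomSum f (k + 1) + d * (k + 1) * altBinomSum f k := by
  unfold altBinomSum
  rw [Finset.sum_range_succ _ (k + 1), Finset.sum_range_succ _ (k + 1), mul_add,
    Finset.mul_sum, Finset.mul_sum, add_right_comm, ← Finset.sum_add_distrib]
  congr 1
  · refine Finset.sum_congr rfl fun j hj => ?_
    have hjk : j ≤ k := Nat.lt_succ_iff.mp (Finset.mem_range.mp hj)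
    have hchoose : ((k : ℝ) + 1) * (k.choose j : ℝ) = ((k + 1).choose j : ℝ) * (k + 1 - j) := by
      have h := Nat.choose_mul_succ_eq k j
      have h' : ((k.choose j * (k + 1) : ℕ) : ℝ) = ((k + 1).choose j * (k + 1 - j) : ℕ) :=
        congrArg _ h
      rw [Nat.cast_mul, Nat.cast_mul, Nat.cast_sub (by omega)] at h'
      push_cast at h'
      linarith
    rw [Nat.succ_sub hjk, pow_succ]
    linear_combination (-(-1 : ℝ) ^ (k - j) * d * f j) * hchoose
  · push_cast
    ring

theorem stmt_0 (a₀ a₁ a₂ : ℝ) (ha₁ : a₁ ≠ 0) (ha₂ : a₂ ≠ 0)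
    (F : ℕ → ℤ → ℝ)
    (hinit : F 0 0 = 1)
    (hzero : ∀ (n : ℕ) (k : ℤ), (k < 0 ∨ (n : ℤ) < k) → F n k = 0)
    (hrec : ∀ n : ℕ, 1 ≤ n → ∀ k : ℤ, 0 ≤ k → k ≤ (n : ℤ) →
      F n k = (a₂ * n + a₁ * k + a₀) * F (n - 1) k + F (n - 1) (k - 1)) :
    ∀ n k : ℕ, k ≤ n →
      F n k = (1 / (a₁ ^ k * (Nat.factorial k : ℝ))) *
        ∑ j ∈ Finset.range (k + 1),
          (-1 : ℝ) ^ (k - j) * (Nat.choose k j : ℝ) *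
            ∏ r ∈ Finset.Icc 1 n, (a₀ + a₁ * j + r * a₂) := by
  have hF : ∀ n k : ℕ, F n k = (1 / (a₁ ^ k * (Nat.factorial k : ℝ))) *
      altBinomSum (fun j => ∏ r ∈ Finset.Icc 1 n, (a₀ + a₁ * j + r * a₂)) k := by
    intro n
    induction n with
    | zero =>
      intro k
      simp only [Finset.Icc_eq_empty_of_lt zero_lt_one, Finset.prod_empty, altBinomSum_one]
      rcases Nat.eq_zero_or_pos k with rfl | hk
      · simp [hinit]
      · rw [hzero 0 k (Or.inr (by exact_mod_cast hk)), if_neg hk.ne', mul_zero]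
    | succ n ih =>
      intro k
      have hstep : F (n + 1) k =
          (a₂ * (n + 1) + a₁ * k + a₀) * F n k + F n ((k : ℤ) - 1) := by
        by_cases hk : k ≤ n + 1
        · simpa using hrec (n + 1) (by omega) k (by omega) (by exact_mod_cast hk)
        · rw [hzero (n + 1) k (by omega), hzero n k (by omega), hzero n (k - 1) (by omega)]
          ring
      have hprod : (fun j : ℕ => ∏ r ∈ Finset.Icc 1 (n + 1), (a₀ + a₁ * j + r * a₂)) =
          fun j : ℕ => (∏ r ∈ Finset.Icc 1 n, (a₀ + a₁ * j + r * a₂)) *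
            ((a₀ + (n + 1) * a₂) + a₁ * j) := by
        funext j
        rw [Finset.prod_Icc_succ_top (by omega)]
        push_cast
        ring
      rw [hstep, hprod, ih k]
      cases k with
      | zero =>
        rw [altBinomSum_affine_mul_zero, hzero n _ (by simp)]
        simp only [Nat.cast_zero]
        ring
      | succ k =>
        have hpred : ((k + 1 : ℕ) : ℤ) - 1 = k := by simp
        rw [altBinomSum_affine_mul_succ, hpred, ih k, Nat.factorial_succ]
        have hk : (Nat.factorial k : ℝ) ≠ 0 := by exact_mod_cast Nat.factorial_ne_zero k
        have hk' : (k : ℝ) + 1 ≠ 0 := by positivity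
        push_cast
        field_simp
        ring
  intro n k _
  exact hF n k
end

section
/- Let a₀, a₁, a₂, b₀, b₁ be real numbers. Let T : ℕ → ℤ → ℝ satisfy T(0,0) = 1, T(n,k) = 0 whenever k < 0 or k > n, and for n ≥ 1, 0 ≤ k ≤ n: T(n,k) = (a₂·n + a₁·k + a₀)·T(n-1,k) + (b₁·k + b₀)·T(n-1,k-1). Let F : ℕ → ℤ → ℝ satisfy F(0,0) = 1, F(n,k) = 0 whenever k < 0 or k > n, and for n ≥ 1, 0 ≤ k ≤ n: F(n,k) = (a₂·n + a₁·k + a₀)·F(n-1,k) + F(n-1,k-1). Then for all n and all 0 ≤ k ≤ n, T(n,k) = (∏_{i=1}^{k} (b₀ + i·b₁)) · F(n,k). -/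
theorem stmt_2 (a₀ a₁ a₂ b₀ b₁ : ℝ)
    (T F : ℕ → ℤ → ℝ)
    (hTinit : T 0 0 = 1)
    (hTzero : ∀ (n : ℕ) (k : ℤ), (k < 0 ∨ (n : ℤ) < k) → T n k = 0)
    (hTrec : ∀ n : ℕ, 1 ≤ n → ∀ k : ℤ, 0 ≤ k → k ≤ (n : ℤ) →
      T n k = (a₂ * n + a₁ * k + a₀) * T (n - 1) k + (b₁ * k + b₀) * T (n - 1) (k - 1))
    (hFinit : F 0 0 = 1)
    (hFzero : ∀ (n : ℕ) (k : ℤ), (k < 0 ∨ (n : ℤ) < k) → F n k = 0)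
    (hFrec : ∀ n : ℕ, 1 ≤ n → ∀ k : ℤ, 0 ≤ k → k ≤ (n : ℤ) →
      F n k = (a₂ * n + a₁ * k + a₀) * F (n - 1) k + F (n - 1) (k - 1)) :
    ∀ n k : ℕ, k ≤ n →
      T n k = (∏ i ∈ Finset.Icc 1 k, (b₀ + i * b₁)) * F n k := by
  intro n
  induction n with
  | zero =>
    intro k hk
    obtain rfl : k = 0 := by omega
    simp [hTinit, hFinit]
  | succ n ih =>
    have ih' : ∀ k : ℕ, T n k = (∏ i ∈ Finset.Icc 1 k, (b₀ + i * b₁)) * F n k := by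
      intro k
      rcases le_or_gt k n with hk | hk
      · exact ih k hk
      · rw [hTzero n k (Or.inr (by exact_mod_cast hk)),
          hFzero n k (Or.inr (by exact_mod_cast hk)), mul_zero]
    intro k hk
    rw [hTrec (n + 1) (by omega) k (by omega) (by exact_mod_cast hk),
      hFrec (n + 1) (by omega) k (by omega) (by exact_mod_cast hk), Nat.add_sub_cancel, ih' k]
    cases k with
    | zero =>
      simp [hTzero n (-1) (by simp), hFzero n (-1) (by simp)]
    | succ k =>
      have hpred : ((k + 1 : ℕ) : ℤ) - 1 = k := by push_cast; ring
      rw [hpred, ih' k, Finset.prod_Icc_succ_top (by omega)]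
      push_cast
      ring
end

section
/- Let m, r be real numbers. Let A : ℕ → ℤ → ℝ satisfy A(0,0) = 1, A(n,k) = 0 whenever k < 0 or k > n, and for n ≥ 1, 0 ≤ k ≤ n the recurrence A(n,k) = (m·k + r)·A(n-1,k) + (m·n − m·k + m − r)·A(n-1,k-1). Then for all n and all 0 ≤ k ≤ n, A(n,k) = ∑_{j=0}^{k} (-1)^j · C(n+1, j) · (m·(k−j) + r)^n. -/
/-- The alternating sum in the explicit formula for the `r`-Whitney–Eulerian numbers. -/
def whitneyEulerianSum (m r : ℝ) (n k : ℕ) : ℝ :=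
  ∑ j ∈ Finset.range (k + 1),
    (-1 : ℝ) ^ j * (Nat.choose (n + 1) j : ℝ) * (m * ((k : ℝ) - j) + r) ^ n

lemma whitneyEulerianSum_zero_right (m r : ℝ) (n : ℕ) :
    whitneyEulerianSum m r n 0 = r ^ n := by
  simp [whitneyEulerianSum]

lemma whitneyEulerianSum_zero_left_succ (m r : ℝ) (k : ℕ) :
    whitneyEulerianSum m r 0 (k + 1) = 0 := by
  unfold whitneyEulerianSum
  rw [Finset.sum_range_succ', Finset.sum_range_succ']
  simp [Nat.choose_succ_succ]

lemma whitneyEulerianSum_succ_succ (m r : ℝ) (n k : ℕ) :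
    whitneyEulerianSum m r (n + 1) (k + 1) =
      (m * (k + 1) + r) * whitneyEulerianSum m r n (k + 1) +
        (m * (n + 1) - m * (k + 1) + m - r) * whitneyEulerianSum m r n k := by
  unfold whitneyEulerianSum
  rw [Finset.sum_range_succ' _ (k + 1), Finset.sum_range_succ' _ (k + 1), mul_add,
    Finset.mul_sum, Finset.mul_sum, add_right_comm (Finset.sum _ _), ← Finset.sum_add_distrib]
  congr 1
  · refine Finset.sum_congr rfl fun j _ => ?_
    have absorb : (Nat.choose (n + 1) (j + 1) : ℝ) * (j + 1) =
        Nat.choose (n + 1) j * (n + 1 - j) := by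
      rcases le_or_gt j (n + 1) with hj | hj
      · have h := Nat.choose_succ_right_eq (n + 1) j
        have h' := congrArg (Nat.cast : ℕ → ℝ) h
        push_cast [Nat.cast_sub hj] at h'
        exact h'
      · simp [Nat.choose_eq_zero_of_lt hj, Nat.choose_eq_zero_of_lt (Nat.lt_succ_of_lt hj)]
    rw [Nat.choose_succ_succ (n + 1) j]
    push_cast
    rw [show m * ((k : ℝ) + 1 - (j + 1)) + r = m * (k - j) + r by ring]
    linear_combination m * (-1) ^ j * (m * ((k : ℝ) - j) + r) ^ n * absorb
  · simp only [pow_zero, Nat.choose_zero_right]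
    push_cast
    ring

theorem stmt_3 (m r : ℝ)
    (A : ℕ → ℤ → ℝ)
    (hinit : A 0 0 = 1)
    (hzero : ∀ (n : ℕ) (k : ℤ), (k < 0 ∨ (n : ℤ) < k) → A n k = 0)
    (hrec : ∀ n : ℕ, 1 ≤ n → ∀ k : ℤ, 0 ≤ k → k ≤ (n : ℤ) →
      A n k = (m * k + r) * A (n - 1) k + (m * n - m * k + m - r) * A (n - 1) (k - 1)) :
    ∀ n k : ℕ, k ≤ n →
      A n k = ∑ j ∈ Finset.range (k + 1),
        (-1 : ℝ) ^ j * (Nat.choose (n + 1) j : ℝ) * (m * ((k : ℝ) - j) + r) ^ n := by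
  suffices h : ∀ n k : ℕ, A n k = whitneyEulerianSum m r n k from fun n k _ => h n k
  intro n
  induction n with
  | zero =>
    rintro (_ | k)
    · simpa [whitneyEulerianSum_zero_right] using hinit
    · rw [whitneyEulerianSum_zero_left_succ]
      exact hzero _ _ (Or.inr (by push_cast; omega))
  | succ n ih =>
    rintro (_ | k)
    · have h := hrec (n + 1) (by omega) 0 le_rfl (by omega)
      have h0 := ih 0
      rw [whitneyEulerianSum_zero_right] at h0 ⊢
      rw [Nat.cast_zero] at h0 ⊢
      rw [h, Nat.add_sub_cancel, h0, hzero n (0 - 1) (Or.inl (by omega))]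
      push_cast
      ring
    · rw [whitneyEulerianSum_succ_succ, ← ih, ← ih]
      rcases le_or_gt k n with hk | hk
      · have h := hrec (n + 1) (by omega) ((k + 1 : ℕ) : ℤ) (by omega) (by omega)
        rw [h, Nat.add_sub_cancel, show ((k + 1 : ℕ) : ℤ) - 1 = k by push_cast; ring]
        push_cast
        ring
      · rw [hzero (n + 1) _ (Or.inr (by omega)), hzero n ((k + 1 : ℕ) : ℤ) (Or.inr (by omega)),
          hzero n k (Or.inr (by omega))]
        ring
end

section
/- Let m, r be real numbers. Let A : ℕ → ℤ → ℝ satisfy A(0,0) = 1, A(n,k) = 0 whenever k < 0 or k > n, and for n ≥ 1, 0 ≤ k ≤ n the recurrence A(n,k) = (m·k + r)·A(n-1,k) + (m·n − m·k + m − r)·A(n-1,k-1). Then for every n, ∑_{k=0}^{n} A(n,k) = m^n · n!. -/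
theorem stmt_4 (m r : ℝ)
    (A : ℕ → ℤ → ℝ)
    (hinit : A 0 0 = 1)
    (hzero : ∀ (n : ℕ) (k : ℤ), (k < 0 ∨ (n : ℤ) < k) → A n k = 0)
    (hrec : ∀ n : ℕ, 1 ≤ n → ∀ k : ℤ, 0 ≤ k → k ≤ (n : ℤ) →
      A n k = (m * k + r) * A (n - 1) k + (m * n - m * k + m - r) * A (n - 1) (k - 1)) :
    ∀ n : ℕ, ∑ k ∈ Finset.range (n + 1), A n k = m ^ n * (Nat.factorial n : ℝ) := by
  intro n
  induction n with
  | zero => simp [hinit]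
  | succ n ih =>
    have hsplit : ∑ k ∈ Finset.range (n + 1 + 1), A (n + 1) k =
        ∑ k ∈ Finset.range (n + 1 + 1), (m * k + r) * A n k +
        ∑ k ∈ Finset.range (n + 1 + 1),
          (m * (n + 1) - m * k + m - r) * A n ((k : ℤ) - 1) := by
      rw [← Finset.sum_add_distrib]
      refine Finset.sum_congr rfl fun k hk => ?_
      rw [Finset.mem_range] at hk
      rw [hrec (n + 1) (by omega) k (by omega) (by omega)]
      simp
    have htop : A n ((n + 1 : ℕ) : ℤ) = 0 := hzero n _ (by omega)
    have hbot : A n (((0 : ℕ) : ℤ) - 1) = 0 := hzero n _ (by omega)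
    have hshift (k : ℕ) : ((k + 1 : ℕ) : ℤ) - 1 = k := by omega
    rw [hsplit, Finset.sum_range_succ, Finset.sum_range_succ' _ (n + 1), htop, hbot,
      mul_zero, mul_zero, add_zero, add_zero, ← Finset.sum_add_distrib]
    calc _ = ∑ k ∈ Finset.range (n + 1), m * (n + 1) * A n k := by
          refine Finset.sum_congr rfl fun k _ => ?_
          rw [hshift]
          push_cast
          ring
      _ = _ := by
          rw [← Finset.mul_sum, ih, Nat.factorial_succ]
          push_cast
          ring
end

section
/- Let a₀, a₁ be real numbers with a₁ ≠ 0. Let F : ℕ → ℤ → ℝ satisfy F(0,0) = 1, F(n,k) = 0 whenever k < 0 or k > n, and for n ≥ 1, 0 ≤ k ≤ n the recurrence F(n,k) = (a₁·k + a₀)·F(n-1,k) + F(n-1,k-1). Then for every real number α and every n, ∑_{k=0}^{n} F(n,k)·α^k = ∑_{k=0}^{n} C(n,k)·a₁^k·a₀^{n−k}·B_k(α/a₁), where B_k(λ) = ∑_{j=0}^{k} S(k,j)·λ^j is the k-th Bell (Touchard) polynomial and S(k,j) are the Stirling numbers of the second kind. -/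
/-- The Stirling numbers of the second kind. -/
def stirling2 : ℕ → ℕ → ℕ
  | 0, 0 => 1
  | 0, _ + 1 => 0
  | _ + 1, 0 => 0
  | n + 1, k + 1 => (k + 1) * stirling2 n (k + 1) + stirling2 n k

/-- The Bell (Touchard) polynomial `B_k(λ) = ∑_{j=0}^{k} S(k,j) λ^j`. -/
noncomputable def bellPoly (k : ℕ) (lam : ℝ) : ℝ :=
  ∑ j ∈ Finset.range (k + 1), (stirling2 k j : ℝ) * lam ^ j

theorem stirling2_eq_zero_of_lt : ∀ {n k : ℕ}, n < k → stirling2 n k = 0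
  | 0, _ + 1, _ => by simp [stirling2]
  | n + 1, k + 1, h => by
    simp [stirling2, stirling2_eq_zero_of_lt (show n < k + 1 by omega),
      stirling2_eq_zero_of_lt (show n < k by omega)]

theorem bellPoly_eq_sum_range {k n : ℕ} (h : k ≤ n) (lam : ℝ) :
    bellPoly k lam = ∑ j ∈ Finset.range (n + 1), (stirling2 k j : ℝ) * lam ^ j := by
  refine Finset.sum_subset (Finset.range_subset_range.mpr (by omega)) fun j _ hj => ?_
  rw [stirling2_eq_zero_of_lt (by simpa [Nat.succ_le_iff] using hj)]
  simp

/-- The binomial transform `∑_{k=0}^{n} C(n,k) x^k y^(n-k) s_k` of a sequence `s`. -/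
noncomputable def binomialTransform (x y : ℝ) (s : ℕ → ℝ) (n : ℕ) : ℝ :=
  ∑ k ∈ Finset.range (n + 1), (Nat.choose n k : ℝ) * x ^ k * y ^ (n - k) * s k

theorem binomialTransform_succ (x y : ℝ) (s : ℕ → ℝ) (n : ℕ) :
    binomialTransform x y s (n + 1) =
      y * binomialTransform x y s n + x * binomialTransform x y (fun k => s (k + 1)) n := by
  have h := Finset.sum_choose_succ_mul (fun k m => x ^ k * y ^ m * s k) n
  simp only [binomialTransform, Finset.mul_sum, mul_assoc] at h ⊢
  rw [h]
  congr 1 <;> refine Finset.sum_congr rfl fun k hk => ?_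
  · rw [Nat.sub_add_comm (Finset.mem_range_succ_iff.mp hk)]
    ring
  · ring

theorem binomialTransform_stirling2_succ_zero (x y : ℝ) (n : ℕ) :
    binomialTransform x y (fun k => (stirling2 k 0 : ℝ)) (n + 1) =
      y * binomialTransform x y (fun k => (stirling2 k 0 : ℝ)) n := by
  rw [binomialTransform_succ]
  simp [stirling2, binomialTransform]

theorem binomialTransform_stirling2_succ_succ (x y : ℝ) (n j : ℕ) :
    binomialTransform x y (fun k => (stirling2 k (j + 1) : ℝ)) (n + 1) =
      (x * (j + 1) + y) * binomialTransform x y (fun k => (stirling2 k (j + 1) : ℝ)) n +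
        x * binomialTransform x y (fun k => (stirling2 k j : ℝ)) n := by
  rw [binomialTransform_succ]
  have h : binomialTransform x y (fun k => (stirling2 (k + 1) (j + 1) : ℝ)) n =
      (j + 1) * binomialTransform x y (fun k => (stirling2 k (j + 1) : ℝ)) n +
        binomialTransform x y (fun k => (stirling2 k j : ℝ)) n := by
    simp only [binomialTransform, Finset.mul_sum, ← Finset.sum_add_distrib]
    refine Finset.sum_congr rfl fun k _ => ?_
    simp only [stirling2]
    push_cast
    ring
  rw [h]
  ring

theorem binomialTransform_stirling2_eq_zero_of_lt (x y : ℝ) {n j : ℕ} (h : n < j) :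
    binomialTransform x y (fun k => (stirling2 k j : ℝ)) n = 0 := by
  refine Finset.sum_eq_zero fun k hk => ?_
  simp [stirling2_eq_zero_of_lt ((Finset.mem_range_succ_iff.mp hk).trans_lt h)]

theorem stmt_7 (a₀ a₁ : ℝ) (ha₁ : a₁ ≠ 0)
    (F : ℕ → ℤ → ℝ)
    (hinit : F 0 0 = 1)
    (hzero : ∀ (n : ℕ) (k : ℤ), (k < 0 ∨ (n : ℤ) < k) → F n k = 0)
    (hrec : ∀ n : ℕ, 1 ≤ n → ∀ k : ℤ, 0 ≤ k → k ≤ (n : ℤ) →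
      F n k = (a₁ * k + a₀) * F (n - 1) k + F (n - 1) (k - 1)) :
    ∀ (α : ℝ) (n : ℕ),
      ∑ k ∈ Finset.range (n + 1), F n k * α ^ k =
        ∑ k ∈ Finset.range (n + 1),
          (Nat.choose n k : ℝ) * a₁ ^ k * a₀ ^ (n - k) * bellPoly k (α / a₁) := by
  have key : ∀ n j : ℕ,
      a₁ ^ j * F n j = binomialTransform a₁ a₀ (fun k => (stirling2 k j : ℝ)) n := by
    intro n
    induction n with
    | zero =>
      rintro (_ | j)
      · simp [binomialTransform, stirling2, hinit]
      · rw [hzero _ _ (Or.inr (by omega)),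
          binomialTransform_stirling2_eq_zero_of_lt _ _ j.succ_pos, mul_zero]
    | succ n ih =>
      intro j
      rcases lt_or_ge (n + 1) j with hj | hj
      · rw [hzero _ _ (Or.inr (by omega)),
          binomialTransform_stirling2_eq_zero_of_lt _ _ hj, mul_zero]
      · rw [hrec (n + 1) (by omega) j (by omega) (by omega), Nat.add_sub_cancel]
        rcases j with _ | j
        · rw [binomialTransform_stirling2_succ_zero, ← ih, hzero n (((0 : ℕ) : ℤ) - 1) (by simp)]
          simp
        · rw [binomialTransform_stirling2_succ_succ, ← ih, ← ih]
          push_cast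
          rw [add_sub_cancel_right]
          ring
  intro α n
  have hbell : ∀ k ∈ Finset.range (n + 1),
      (Nat.choose n k : ℝ) * a₁ ^ k * a₀ ^ (n - k) * bellPoly k (α / a₁) =
        ∑ j ∈ Finset.range (n + 1),
          (Nat.choose n k : ℝ) * a₁ ^ k * a₀ ^ (n - k) * stirling2 k j * (α / a₁) ^ j := by
    intro k hk
    rw [bellPoly_eq_sum_range (Finset.mem_range_succ_iff.mp hk), Finset.mul_sum]
    simp only [mul_assoc]
  rw [Finset.sum_congr rfl hbell, Finset.sum_comm]
  refine Finset.sum_congr rfl fun j _ => ?_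
  rw [← Finset.sum_mul]
  change _ = binomialTransform a₁ a₀ (fun k => (stirling2 k j : ℝ)) n * _
  rw [← key, div_pow]
  field_simp
end

section
/- Let a₀, a₁, a₂, b₀, b₁, b₂ be natural numbers. Let D be the unique derivation on the polynomial ring ℚ[u,v] (multivariate polynomials in two variables over ℚ) determined by D(u) = u^{b₁+b₂+1}·v^{a₁+a₂} and D(v) = u^{b₂}·v^{a₂+1}. Let T : ℕ → ℤ → ℚ satisfy T(0,0) = 1, T(n,k) = 0 whenever k < 0 or k > n, and for n ≥ 1, 0 ≤ k ≤ n the recurrence T(n,k) = (a₂·n + a₁·k + a₀)·T(n-1,k) + (b₂·n + b₁·k + b₀)·T(n-1,k-1). Then for every n, D^n(u^{b₀+b₁+b₂}·v^{a₀+a₂}) = ∑_{k=0}^{n} T(n,k)·u^{b₂n + b₁k + b₀ + b₁ + b₂}·v^{a₂n + a₁k + a₀ + a₂}. -/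
open MvPolynomial

/-- A derivation `D` with `D x = x * y` satisfies `D (x ^ n) = n * x ^ n * y`. -/
theorem Derivation.map_pow_of_map_eq_mul {R A : Type*} [CommSemiring R] [CommSemiring A]
    [Algebra R A] (D : Derivation R A A) {x y : A} (h : D x = x * y) (n : ℕ) :
    D (x ^ n) = n * x ^ n * y := by
  cases n with
  | zero => simp
  | succ n =>
    rw [Derivation.leibniz_pow, h]
    simp only [smul_eq_mul, nsmul_eq_mul, Nat.add_sub_cancel]
    ring

theorem stmt_10 (a₀ a₁ a₂ b₀ b₁ b₂ : ℕ)
    (D : Derivation ℚ (MvPolynomial (Fin 2) ℚ) (MvPolynomial (Fin 2) ℚ))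
    (hDu : D (X 0) = X 0 ^ (b₁ + b₂ + 1) * X 1 ^ (a₁ + a₂))
    (hDv : D (X 1) = X 0 ^ b₂ * X 1 ^ (a₂ + 1))
    (T : ℕ → ℤ → ℚ)
    (hinit : T 0 0 = 1)
    (hzero : ∀ (n : ℕ) (k : ℤ), (k < 0 ∨ (n : ℤ) < k) → T n k = 0)
    (hrec : ∀ n : ℕ, 1 ≤ n → ∀ k : ℤ, 0 ≤ k → k ≤ (n : ℤ) →
      T n k = ((a₂ : ℚ) * n + (a₁ : ℚ) * k + (a₀ : ℚ)) * T (n - 1) k +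
        ((b₂ : ℚ) * n + (b₁ : ℚ) * k + (b₀ : ℚ)) * T (n - 1) (k - 1)) :
    ∀ n : ℕ, (⇑D)^[n] (X 0 ^ (b₀ + b₁ + b₂) * X 1 ^ (a₀ + a₂)) =
      ∑ k ∈ Finset.range (n + 1),
        C (T n k) * X 0 ^ (b₂ * n + b₁ * k + b₀ + b₁ + b₂) *
          X 1 ^ (a₂ * n + a₁ * k + a₀ + a₂) := by
  have hpow (p q : ℕ) (c : ℚ) : D (C c * X 0 ^ p * X 1 ^ q) =
      C ((q : ℚ) * c) * X 0 ^ (p + b₂) * X 1 ^ (q + a₂) +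
        C ((p : ℚ) * c) * X 0 ^ (p + b₁ + b₂) * X 1 ^ (q + a₁ + a₂) := by
    have hu := D.map_pow_of_map_eq_mul (y := X 0 ^ (b₁ + b₂) * X 1 ^ (a₁ + a₂))
      (by rw [hDu]; ring) p
    have hv := D.map_pow_of_map_eq_mul (y := X 0 ^ b₂ * X 1 ^ a₂) (by rw [hDv]; ring) q
    have hC : D (C c) = 0 := D.map_algebraMap c
    simp only [Derivation.leibniz, hu, hv, hC, smul_eq_mul, map_mul, map_natCast]
    ring
  intro n
  induction n with
  | zero => simp [hinit, add_assoc]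
  | succ n ih =>
    rw [Function.iterate_succ_apply', ih, map_sum]
    simp only [hpow, Finset.sum_add_distrib]
    have hsplit (k : ℕ) (hk : k ∈ Finset.range (n + 1 + 1)) :
        (C (T (n + 1) k) * X 0 ^ (b₂ * (n + 1) + b₁ * k + b₀ + b₁ + b₂) *
          X 1 ^ (a₂ * (n + 1) + a₁ * k + a₀ + a₂) : MvPolynomial (Fin 2) ℚ) =
        C (((a₂ : ℚ) * (n + 1) + a₁ * k + a₀) * T n k) *
            X 0 ^ (b₂ * (n + 1) + b₁ * k + b₀ + b₁ + b₂) *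
            X 1 ^ (a₂ * (n + 1) + a₁ * k + a₀ + a₂) +
          C (((b₂ : ℚ) * (n + 1) + b₁ * k + b₀) * T n (k - 1)) *
            X 0 ^ (b₂ * (n + 1) + b₁ * k + b₀ + b₁ + b₂) *
            X 1 ^ (a₂ * (n + 1) + a₁ * k + a₀ + a₂) := by
      rw [Finset.mem_range] at hk
      rw [hrec (n + 1) (by omega) k (by omega) (by omega), Nat.add_sub_cancel, map_add]
      push_cast
      ring
    rw [Finset.sum_congr rfl hsplit, Finset.sum_add_distrib]
    congr 1
    · rw [Finset.sum_range_succ _ (n + 1), hzero n ((n + 1 : ℕ) : ℤ) (Or.inr (by omega))]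
      simp only [mul_zero, map_zero, zero_mul, add_zero]
      refine Finset.sum_congr rfl fun k _ => ?_
      push_cast
      ring_nf
    · rw [Finset.sum_range_succ' _ (n + 1), hzero n (((0 : ℕ) : ℤ) - 1) (Or.inl (by omega))]
      simp only [mul_zero, map_zero, zero_mul, add_zero]
      refine Finset.sum_congr rfl fun k _ => ?_
      rw [show ((k + 1 : ℕ) : ℤ) - 1 = k by omega]
      push_cast
      ring_nf
end

section
/- Let m, r be natural numbers with r ≤ m. Let D be the unique derivation on the polynomial ring ℚ[u,v] determined by D(u) = u·v^m and D(v) = u^m·v. Let A : ℕ → ℤ → ℚ satisfy A(0,0) = 1, A(n,k) = 0 whenever k < 0 or k > n, and for n ≥ 1, 0 ≤ k ≤ n the recurrence A(n,k) = (m·k + r)·A(n-1,k) + (m·(n−k) + m − r)·A(n-1,k-1). Then for every n, D^n(u^{m−r}·v^{r}) = ∑_{k=0}^{n} A(n,k)·u^{m·n − m·k + m − r}·v^{m·k + r}. -/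
open MvPolynomial

/-- If `D x = x * y`, then `D (x ^ n) = n * x ^ n * y`. -/
theorem derivation_pow_of_apply_eq_mul {R S : Type*} [CommSemiring R] [CommSemiring S]
    [Algebra R S] (D : Derivation R S S) {x y : S} (h : D x = x * y) (n : ℕ) :
    D (x ^ n) = n * x ^ n * y := by
  induction n with
  | zero => simp
  | succ n ih =>
    rw [pow_succ, D.leibniz, ih, h]
    simp only [smul_eq_mul]
    push_cast
    ring

/-- The action of `D` on the monomial `c * u ^ a * v ^ b`, where `D u = u * v ^ m` and
`D v = u ^ m * v`. -/
theorem derivation_C_mul_monomial (m : ℕ)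
    (D : Derivation ℚ (MvPolynomial (Fin 2) ℚ) (MvPolynomial (Fin 2) ℚ))
    (hDu : D (X 0) = X 0 * X 1 ^ m) (hDv : D (X 1) = X 0 ^ m * X 1) (c : ℚ) (a b : ℕ) :
    D (C c * X 0 ^ a * X 1 ^ b) =
      C (b * c) * X 0 ^ (a + m) * X 1 ^ b + C (a * c) * X 0 ^ a * X 1 ^ (b + m) := by
  rw [mul_comm] at hDv
  rw [mul_assoc, ← smul_eq_C_mul, D.map_smul, D.leibniz, derivation_pow_of_apply_eq_mul D hDu,
    derivation_pow_of_apply_eq_mul D hDv, smul_eq_C_mul]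
  simp only [smul_eq_mul, C_mul, map_natCast]
  ring

theorem stmt_11 (m r : ℕ) (hrm : r ≤ m)
    (D : Derivation ℚ (MvPolynomial (Fin 2) ℚ) (MvPolynomial (Fin 2) ℚ))
    (hDu : D (X 0) = X 0 * X 1 ^ m)
    (hDv : D (X 1) = X 0 ^ m * X 1)
    (A : ℕ → ℤ → ℚ)
    (hinit : A 0 0 = 1)
    (hzero : ∀ (n : ℕ) (k : ℤ), (k < 0 ∨ (n : ℤ) < k) → A n k = 0)
    (hrec : ∀ n : ℕ, 1 ≤ n → ∀ k : ℤ, 0 ≤ k → k ≤ (n : ℤ) →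
      A n k = ((m : ℚ) * k + (r : ℚ)) * A (n - 1) k +
        ((m : ℚ) * ((n : ℚ) - k) + (m : ℚ) - (r : ℚ)) * A (n - 1) (k - 1)) :
    ∀ n : ℕ, (⇑D)^[n] (X 0 ^ (m - r) * X 1 ^ r) =
      ∑ k ∈ Finset.range (n + 1),
        C (A n k) * X 0 ^ (m * n - m * k + m - r) * X 1 ^ (m * k + r) := by
  intro n
  induction n with
  | zero => simp [hinit]
  | succ n ih =>
    rw [Function.iterate_succ_apply', ih, map_sum]
    simp only [derivation_C_mul_monomial m D hDu hDv]
    have hsplit : ∀ k ∈ Finset.range (n + 1 + 1),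
        (C (A (n + 1) k) * X 0 ^ (m * (n + 1) - m * k + m - r) * X 1 ^ (m * k + r) :
          MvPolynomial (Fin 2) ℚ) =
        C (((m : ℚ) * k + r) * A n k) *
            X 0 ^ (m * (n + 1) - m * k + m - r) * X 1 ^ (m * k + r) +
          C (((m : ℚ) * ((n : ℚ) + 1 - k) + m - r) * A n (k - 1)) *
            X 0 ^ (m * (n + 1) - m * k + m - r) * X 1 ^ (m * k + r) := by
      intro k hk
      have hk' := Finset.mem_range.mp hk
      rw [hrec (n + 1) (by omega) k (by omega) (by omega)]
      simp only [Nat.add_sub_cancel, Nat.cast_add, Nat.cast_one, Int.cast_natCast, C_add, add_mul]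
    rw [Finset.sum_congr rfl hsplit, Finset.sum_add_distrib, Finset.sum_add_distrib,
      Finset.sum_range_succ _ (n + 1), Finset.sum_range_succ' _ (n + 1),
      hzero n ((n + 1 : ℕ) : ℤ) (by right; omega), hzero n (((0 : ℕ) : ℤ) - 1) (by left; omega)]
    simp only [mul_zero, C_0, zero_mul, add_zero]
    congr 1
    all_goals
      refine Finset.sum_congr rfl fun k hk => ?_
      obtain ⟨d, rfl⟩ := Nat.exists_eq_add_of_le (Nat.lt_succ_iff.mp (Finset.mem_range.mp hk))
      obtain ⟨s, rfl⟩ := Nat.exists_eq_add_of_le hrm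
    · have h1 : (r + s) * (k + d) - (r + s) * k + (r + s) - r = (r + s) * d + s := by
        rw [mul_add]; omega
      have h2 : (r + s) * (k + d + 1) - (r + s) * k + (r + s) - r
          = (r + s) * d + s + (r + s) := by
        rw [mul_add, mul_add]; omega
      rw [h1, h2]
      push_cast
      rfl
    · have h1 : (r + s) * (k + d) - (r + s) * k + (r + s) - r = (r + s) * d + s := by
        rw [mul_add]; omega
      have h2 : (r + s) * (k + d + 1) - (r + s) * (k + 1) + (r + s) - r = (r + s) * d + s := by
        rw [mul_add, mul_add, mul_add]; omega
      have h3 : (((k + 1 : ℕ) : ℤ) - 1) = k := by push_cast; ring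
      rw [h1, h2, h3]
      congr 2
      · congr 2
        push_cast
        ring
      · ring
end

section
/- Let r ≥ 1 be a natural number. Let D be the unique derivation on the polynomial ring ℚ[x,y] determined by D(x) = x^r·y and D(y) = x^r·y. Let B : ℕ → ℤ → ℚ satisfy B(0,0) = 1, B(n,k) = 0 whenever k < 0 or k ≥ n (for n ≥ 1), and for n ≥ 1, 0 ≤ k ≤ n−1 the recurrence B(n,k) = (k+1)·B(n-1,k) + (r·n − k + 1 − r)·B(n-1,k-1). Then for every n, D^n(y) = ∑_{k=0}^{n} B(n,k)·x^{n·r − k}·y^{k+1}. -/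
open MvPolynomial

theorem Derivation.map_C_mul_pow_mul_pow (r : ℕ)
    (D : Derivation ℚ (MvPolynomial (Fin 2) ℚ) (MvPolynomial (Fin 2) ℚ))
    (hDx : D (X 0) = X 0 ^ r * X 1) (hDy : D (X 1) = X 0 ^ r * X 1) (b : ℚ) {m k : ℕ}
    (hkm : k ≤ m) :
    D (C b * X 0 ^ (m - k) * X 1 ^ (k + 1)) =
      C (((k : ℚ) + 1) * b) * (X 0 ^ (m + r - k) * X 1 ^ (k + 1)) +
        C (((m : ℚ) - k) * b) * (X 0 ^ (m + r - (k + 1)) * X 1 ^ (k + 2)) := by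
  obtain ⟨a, rfl⟩ := Nat.exists_eq_add_of_le hkm
  have hDC : D (C b) = 0 := D.map_algebraMap b
  have hk : (C (k : ℚ) : MvPolynomial (Fin 2) ℚ) = (k : MvPolynomial (Fin 2) ℚ) :=
    _root_.map_natCast C k
  have ha : (C (a : ℚ) : MvPolynomial (Fin 2) ℚ) = (a : MvPolynomial (Fin 2) ℚ) :=
    _root_.map_natCast C a
  rw [show k + a - k = a by omega, show k + a + r - k = a + r by omega,
    show ((k + a : ℕ) : ℚ) - k = a by push_cast; ring]
  simp only [Derivation.leibniz, Derivation.leibniz_pow, hDC, hDx, hDy, smul_eq_mul, nsmul_eq_mul,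
    C_mul, C_add, C_1, hk, ha]
  rcases a with _ | a
  · simp
    ring
  · rw [show k + (a + 1) + r - (k + 1) = a + r by omega]
    simp only [Nat.add_sub_cancel]
    push_cast
    ring

theorem stmt_12 (r : ℕ) (hr : 1 ≤ r)
    (D : Derivation ℚ (MvPolynomial (Fin 2) ℚ) (MvPolynomial (Fin 2) ℚ))
    (hDx : D (X 0) = X 0 ^ r * X 1)
    (hDy : D (X 1) = X 0 ^ r * X 1)
    (B : ℕ → ℤ → ℚ)
    (hinit : B 0 0 = 1)
    (hzero : ∀ (n : ℕ) (k : ℤ), (k < 0 ∨ (1 ≤ n ∧ (n : ℤ) ≤ k)) → B n k = 0)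
    (hrec : ∀ n : ℕ, 1 ≤ n → ∀ k : ℤ, 0 ≤ k → k ≤ (n : ℤ) - 1 →
      B n k = ((k : ℚ) + 1) * B (n - 1) k +
        ((r : ℚ) * n - (k : ℚ) + 1 - (r : ℚ)) * B (n - 1) (k - 1)) :
    ∀ n : ℕ, (⇑D)^[n] (X 1) =
      ∑ k ∈ Finset.range (n + 1),
        C (B n k) * X 0 ^ (n * r - k) * X 1 ^ (k + 1) := by
  intro n
  induction n with
  | zero => simp [hinit]
  | succ n ih =>
    rw [Function.iterate_succ_apply', ih, map_sum]
    have hterm : ∀ k ∈ Finset.range (n + 1),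
        D (C (B n k) * X 0 ^ (n * r - k) * X 1 ^ (k + 1)) = _ := fun k hk =>
      Derivation.map_C_mul_pow_mul_pow r D hDx hDy (B n k)
        ((Finset.mem_range_succ_iff.mp hk).trans (Nat.le_mul_of_pos_right n hr))
    have hcoeff : ∀ k ∈ Finset.range (n + 1),
        C (B (n + 1) k) * X 0 ^ ((n + 1) * r - k) * X 1 ^ (k + 1) =
          C (((k : ℚ) + 1) * B n k) * (X 0 ^ (n * r + r - k) * X 1 ^ (k + 1)) +
            C (((n * r : ℕ) - (k : ℚ) + 1) * B n ((k : ℤ) - 1)) *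
              (X 0 ^ (n * r + r - k) * X 1 ^ (k + 1) : MvPolynomial (Fin 2) ℚ) := by
      intro k hk
      have hkn := Finset.mem_range_succ_iff.mp hk
      have hB := hrec (n + 1) (by omega) k (by omega) (by push_cast; omega)
      rw [Nat.add_sub_cancel] at hB
      rw [hB, Nat.succ_mul, ← add_mul, ← C_add, mul_assoc]
      congr 2
      push_cast
      ring
    have hlast : ((n * r : ℕ) - (n : ℚ)) * B n n = 0 := by
      rcases Nat.eq_zero_or_pos n with rfl | hn
      · simp
      · rw [hzero n n (Or.inr ⟨hn, le_rfl⟩), mul_zero]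
    rw [Finset.sum_congr rfl hterm, Finset.sum_range_succ _ (n + 1),
      hzero (n + 1) (n + 1 : ℕ) (Or.inr ⟨by omega, le_rfl⟩), Finset.sum_congr rfl hcoeff,
      Finset.sum_add_distrib, Finset.sum_add_distrib]
    simp only [C_0, zero_mul, add_zero]
    congr 1
    rw [Finset.sum_range_succ, hlast, Finset.sum_range_succ', hzero n _ (Or.inl (by simp))]
    simp only [mul_zero, C_0, zero_mul, add_zero]
    refine Finset.sum_congr rfl fun k _ => ?_
    push_cast
    rw [add_sub_cancel_right, sub_add_eq_sub_sub, sub_add_cancel]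
end

section
/- Let a ≥ 1 be a natural number and u, v real numbers. Define U, V : ℝ → ℝ by U(t) = u·exp((v^a / a)·(e^{a·t} − 1)) and V(t) = v·e^{t}. Then U(0) = u, V(0) = v, and for every real t, U has derivative U(t)·(V(t))^a at t and V has derivative V(t) at t; i.e., (U, V) is the solution of the system U′ = U·V^a, V′ = V with initial conditions U(0) = u, V(0) = v. -/
theorem stmt_15 (a : ℕ) (ha : 1 ≤ a) (u v : ℝ)
    (U V : ℝ → ℝ)
    (hU : U = fun t => u * Real.exp ((v ^ a / (a : ℝ)) * (Real.exp ((a : ℝ) * t) - 1)))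
    (hV : V = fun t => v * Real.exp t) :
    U 0 = u ∧ V 0 = v ∧
      ∀ t : ℝ, HasDerivAt U (U t * (V t) ^ a) t ∧ HasDerivAt V (V t) t := by
  have ha0 : (a : ℝ) ≠ 0 := by positivity
  subst hU hV
  refine ⟨by simp, by simp, fun t => ⟨?_, (Real.hasDerivAt_exp t).const_mul v⟩⟩
  have h := (((((hasDerivAt_id t).const_mul (a : ℝ)).exp.sub_const 1).const_mul
    (v ^ a / (a : ℝ))).exp).const_mul u
  refine h.congr_deriv ?_
  simp only [id, mul_pow, ← Real.exp_nat_mul]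
  field_simp
end

section
/- Let a ≥ 1 be a natural number, u a real number, and v > 0 a real number. For real t with v^{−a} − a·t > 0, define V(t) = (v^{−a} − a·t)^{−1/a} (real power of a positive base) and U(t) = (u/v)·V(t). Then U(0) = u, V(0) = v, and for every t with v^{−a} − a·t > 0, V has derivative (V(t))^{a+1} at t and U has derivative U(t)·(V(t))^{a} at t; i.e., (U, V) solves the system U′ = U·V^{a}, V′ = V^{a+1} with initial conditions U(0) = u, V(0) = v on the interval where v^{−a} − a·t > 0. -/
theorem stmt_16 (a : ℕ) (ha : 1 ≤ a) (u : ℝ) (v : ℝ) (hv : 0 < v)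
    (U V : ℝ → ℝ)
    (hV : V = fun t => ((v ^ a)⁻¹ - (a : ℝ) * t) ^ (-(1 : ℝ) / (a : ℝ)))
    (hU : U = fun t => (u / v) * V t) :
    U 0 = u ∧ V 0 = v ∧
      ∀ t : ℝ, 0 < (v ^ a)⁻¹ - (a : ℝ) * t →
        HasDerivAt V ((V t) ^ (a + 1)) t ∧ HasDerivAt U (U t * (V t) ^ a) t := by
  have ha₀ : a ≠ 0 := by omega
  have ha' : (a : ℝ) ≠ 0 := Nat.cast_ne_zero.mpr ha₀
  have hV₀ : V 0 = v := by
    simp only [hV, mul_zero, sub_zero]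
    rw [neg_div, one_div, Real.rpow_neg (by positivity), Real.inv_rpow (by positivity), inv_inv,
      Real.pow_rpow_inv_natCast hv.le ha₀]
  refine ⟨by simp only [hU, hV₀]; field_simp, hV₀, fun t ht => ?_⟩
  have hderiv : HasDerivAt V ((V t) ^ (a + 1)) t := by
    have hlin : HasDerivAt (fun s : ℝ => (v ^ a)⁻¹ - (a : ℝ) * s) (-(a : ℝ)) t := by
      simpa using ((hasDerivAt_id t).const_mul (a : ℝ)).const_sub (v ^ a)⁻¹
    have hpow := hlin.rpow_const (p := -(1 : ℝ) / (a : ℝ)) (Or.inl ht.ne')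
    rw [hV]
    convert hpow using 1
    rw [← Real.rpow_mul_natCast ht.le]
    have hexp : -(1 : ℝ) / (a : ℝ) * ((a + 1 : ℕ) : ℝ) = -(1 : ℝ) / (a : ℝ) - 1 := by
      push_cast
      field_simp
      ring
    rw [hexp]
    field_simp
  refine ⟨hderiv, ?_⟩
  rw [hU]
  exact (hderiv.const_mul (u / v)).congr_deriv (by ring)
end
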